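/- Let k and p be positive integers and γ ≥ 1 a real number. Let G be a graph containing a cycle C of length at least 2γpk which is the 𝔃₂-sum of a family of cycles of G each of length at most p, and such that the metric of C is distorted by a factor of at most γ, i.e., d_G(u,v) ≥ d_C(u,v)/γ for all vertices u, v ∈ V(C). Then the tree-width of G is at least k. -/

import Mathlib

open SimpleGraph

/-- A tree-decomposition of a graph `G`. -/
structure TreeDecomp {V : Type u} (G : SimpleGraph V) : Type (u + 1) where
  ι : Type u
  T : SimpleGraph ι
  conn : T.Connected
  acyc : T.IsAcyclic
  bag : ι → Set V
  covers : ∀ v : V, ∃ i, v ∈ bag i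
  coversEdges : ∀ ⦃x y : V⦄, G.Adj x y → ∃ i, x ∈ bag i ∧ y ∈ bag i
  coherent : ∀ (v : V) ⦃i j : ι⦄ (p : T.Walk i j), p.IsPath → v ∈ bag i → v ∈ bag j →
      ∀ k ∈ p.support, v ∈ bag k

/-- The width of a tree-decomposition: maximum bag size minus one. -/
noncomputable def TreeDecomp.width {V : Type u} {G : SimpleGraph V} (td : TreeDecomp G) : ℕ :=
  (⨆ i, (td.bag i).ncard) - 1

/-- The tree-width of a graph: the minimum width of a tree-decomposition. -/
noncomputable def treewidth {V : Type u} (G : SimpleGraph V) : ℕ :=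
  sInf {w | ∃ td : TreeDecomp G, td.width = w}

/-- The vertices reachable from `a` by a walk of `G` that avoids `X`. -/
def avoidComp {V : Type*} (G : SimpleGraph V) (X : Set V) (a : V) : Set V :=
  {b | ∃ q : G.Walk a b, ∀ z ∈ q.support, z ∉ X}

theorem notMem_of_mem_avoidComp {V : Type*} {G : SimpleGraph V} {X : Set V} {a b : V}
    (h : b ∈ avoidComp G X a) : b ∉ X := by
  obtain ⟨q, hq⟩ := h
  exact hq b q.end_mem_support

theorem mem_avoidComp_self {V : Type*} {G : SimpleGraph V} {X : Set V} {a : V}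
    (h : a ∉ X) : a ∈ avoidComp G X a :=
  ⟨Walk.nil, by simpa using h⟩

theorem mem_avoidComp_of_adj {V : Type*} {G : SimpleGraph V} {X : Set V} {a x y : V}
    (hx : x ∈ avoidComp G X a) (hxy : G.Adj x y) (hy : y ∉ X) : y ∈ avoidComp G X a := by
  obtain ⟨q, hq⟩ := hx
  refine ⟨q.concat hxy, fun z hz => ?_⟩
  rw [Walk.support_concat] at hz
  simp only [List.mem_append, List.mem_singleton] at hz
  rcases hz with hz | rfl
  · exact hq z hz
  · exact hy

theorem mem_of_walk_of_closed {V : Type*} {G : SimpleGraph V} {K X : Set V}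
    (hK : ∀ x ∈ K, ∀ y, G.Adj x y → y ∉ X → y ∈ K) {x y : V} (q : G.Walk x y)
    (hq : ∀ z ∈ q.support, z ∉ X) (hx : x ∈ K) : ∀ z ∈ q.support, z ∈ K := by
  induction q with
  | nil => simpa using hx
  | cons h q ih =>
    simp only [Walk.support_cons, List.mem_cons, forall_eq_or_imp] at hq ⊢
    exact ⟨hx, ih hq.2 (hK _ hx _ h (hq.2 _ q.start_mem_support))⟩

theorem avoidComp_subset_of_closed {V : Type*} {G : SimpleGraph V} {K X : Set V}
    (hK : ∀ x ∈ K, ∀ y, G.Adj x y → y ∉ X → y ∈ K) {a : V}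
    (hmeet : (avoidComp G X a ∩ K).Nonempty) : avoidComp G X a ⊆ K := by
  obtain ⟨z, ⟨q, hq⟩, hzK⟩ := hmeet
  rintro b ⟨q', hq'⟩
  refine mem_of_walk_of_closed hK (q.reverse.append q') (fun x hx => ?_) hzK b
    (Walk.end_mem_support _)
  rw [Walk.mem_support_append_iff, Walk.support_reverse, List.mem_reverse] at hx
  exact hx.elim (hq x) (hq' x)

/-- A component of the complement of a bag lies on one side of that bag: its attachments
are also in the next bag towards any node `t` whose bag meets the component. -/
theorem TreeDecomp.exists_closer_bag {V : Type u} {G : SimpleGraph V} (td : TreeDecomp G)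
    {i t : td.ι} {a w : V} (hw : w ∈ avoidComp G (td.bag i) a) (hwt : w ∈ td.bag t) :
    ∃ j, td.T.dist j t < td.T.dist i t ∧
      ∀ x ∈ avoidComp G (td.bag i) a, ∀ y, G.Adj x y → y ∈ td.bag i → y ∈ td.bag j := by
  classical
  obtain ⟨P, hP, hPl⟩ := td.conn.exists_path_of_dist i t
  cases P with
  | nil => exact absurd hwt (notMem_of_mem_avoidComp hw)
  | @cons _ j _ hij P =>
    rw [Walk.cons_isPath_iff] at hP
    refine ⟨j, ?_, ?_⟩
    · have := td.T.dist_le P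
      rw [Walk.length_cons] at hPl
      omega
    · let R : td.ι → Prop := fun s => ∃ q : td.T.Walk j s, i ∉ q.support
      have hRt : R t := ⟨P, hP.2⟩
      have hstep : ∀ {x : V} {s s' : td.ι}, x ∉ td.bag i → x ∈ td.bag s → x ∈ td.bag s' →
          R s → R s' := by
        rintro x s s' hxi hs hs' ⟨q, hq⟩
        obtain ⟨r, hr, -⟩ := td.conn.exists_path_of_dist s s'
        refine ⟨q.append r, fun hi => ?_⟩
        rw [Walk.mem_support_append_iff] at hi
        exact hi.elim hq fun hi => hxi (td.coherent x r hr hs hs' i hi)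
      have hall : ∀ x ∈ avoidComp G (td.bag i) a, ∀ s, x ∈ td.bag s → R s := by
        intro x hx s hs
        obtain ⟨q, hq⟩ := hw
        obtain ⟨q', hq'⟩ := hx
        refine mem_of_walk_of_closed (G := G) (X := td.bag i)
          (K := {x | x ∉ td.bag i ∧ ∀ s, x ∈ td.bag s → R s}) ?_ (q.reverse.append q')
          (fun z hz => ?_) ⟨hq w q.end_mem_support, fun s hs => ?_⟩ x (Walk.end_mem_support _)
          |>.2 s hs
        · rintro x ⟨hxi, hx⟩ y hxy hy
          refine ⟨hy, fun s hs => ?_⟩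
          obtain ⟨s', hxs', hys'⟩ := td.coversEdges hxy
          exact hstep hy hys' hs (hx s' hxs')
        · rw [Walk.mem_support_append_iff, Walk.support_reverse, List.mem_reverse] at hz
          exact hz.elim (hq z) (hq' z)
        · exact hstep (hq w q.end_mem_support) hwt hs hRt
      intro x hx y hxy hyi
      obtain ⟨s, hxs, hys⟩ := td.coversEdges hxy
      obtain ⟨q, hq⟩ := hall x hx s hxs
      refine td.coherent y (Walk.cons hij q.bypass)
        ((Walk.cons_isPath_iff _ _).2
          ⟨q.bypass_isPath, fun h => hq (q.support_bypass_subset_support h)⟩)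
        hyi hys j ?_
      simp

/-- One cannot choose a component of the complement of every bag so that the chosen components
pairwise meet. -/
theorem TreeDecomp.exists_disjoint_avoidComp {V : Type u} [Finite V] {G : SimpleGraph V}
    (td : TreeDecomp G) (a : td.ι → V) (ha : ∀ i, a i ∉ td.bag i) :
    ∃ i j, ¬ (avoidComp G (td.bag i) (a i) ∩ avoidComp G (td.bag j) (a j)).Nonempty := by
  by_contra! hmeet
  let K : td.ι → Set V := fun i => avoidComp G (td.bag i) (a i)
  obtain ⟨i₀⟩ := td.conn.nonempty
  obtain ⟨i₁, -, hi₁⟩ := exists_minimalFor_of_wellFoundedLT (fun _ => True) (fun i => (K i).ncard)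
    ⟨i₀, trivial⟩
  obtain ⟨t, ht⟩ := td.covers (a i₁)
  obtain ⟨i, hi, hmin⟩ := exists_minimalFor_of_wellFoundedLT (fun i => K i = K i₁)
    (fun i => td.T.dist i t) ⟨i₁, rfl⟩
  have hw : a i₁ ∈ K i := hi ▸ mem_avoidComp_self (ha i₁)
  obtain ⟨j, hjt, hj⟩ := td.exists_closer_bag hw ht
  have hsub : K j ⊆ K i := by
    refine avoidComp_subset_of_closed (fun x hx y hxy hy => ?_) (hmeet j i)
    exact mem_avoidComp_of_adj hx hxy fun hyi => hy (hj x hx y hxy hyi)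
  have hle : (K i).ncard ≤ (K j).ncard := by
    rw [hi]
    exact (le_total _ _).elim id fun h => hi₁ trivial h
  have heq : K j = K i := Set.eq_of_subset_of_ncard_le hsub hle
  exact absurd (hmin (heq.trans hi) hjt.le) (not_le.2 hjt)

theorem exists_treeDecomp {V : Type u} (G : SimpleGraph V) : Nonempty (TreeDecomp G) :=
  ⟨{  ι := PUnit
      T := ⊥
      conn := ⟨fun _ _ => Reachable.refl _⟩
      acyc := isAcyclic_bot
      bag := fun _ => Set.univ
      covers := fun _ => ⟨PUnit.unit, trivial⟩
      coversEdges := fun _ _ _ => ⟨PUnit.unit, trivial, trivial⟩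
      coherent := fun _ _ _ _ _ _ _ _ _ => trivial }⟩

/-- If every set of at most `k` vertices leaves a component that contains more than half of a
fixed vertex set, then the tree-width is at least `k`. -/
theorem le_treewidth_of_majority {V : Type u} [Finite V] (G : SimpleGraph V) {k : ℕ} (S : Set V)
    (h : ∀ X : Set V, X.ncard ≤ k →
      ∃ a, a ∉ X ∧ S.ncard < 2 * (avoidComp G X a ∩ S).ncard) : k ≤ treewidth G := by
  refine le_csInf ?_ ?_
  · obtain ⟨td⟩ := exists_treeDecomp G
    exact ⟨_, td, rfl⟩
  · rintro _ ⟨td, rfl⟩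
    by_contra! hlt
    have hbdd : BddAbove (Set.range fun i => (td.bag i).ncard) :=
      ⟨Nat.card V, by rintro _ ⟨i, rfl⟩; exact Set.ncard_le_card _⟩
    have hbag : ∀ i, (td.bag i).ncard ≤ k := fun i => by
      have := le_ciSup hbdd i
      unfold TreeDecomp.width at hlt
      omega
    choose a ha hS using fun i => h _ (hbag i)
    obtain ⟨i, j, hij⟩ := td.exists_disjoint_avoidComp a ha
    refine hij ?_
    by_contra hne
    rw [Set.not_nonempty_iff_eq_empty, ← Set.disjoint_iff_inter_eq_empty] at hne
    have hun := Set.ncard_union_eq (hne.mono (Set.inter_subset_left (t := S))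
      (Set.inter_subset_left (t := S))) (Set.toFinite _) (Set.toFinite _)
    have hle := Set.ncard_le_ncard (Set.union_subset
      (Set.inter_subset_right (s := avoidComp G (td.bag i) (a i)) (t := S))
      (Set.inter_subset_right (s := avoidComp G (td.bag j) (a j)) (t := S))) (Set.toFinite _)
    have h1 := hS i
    have h2 := hS j
    omega

/-- The symmetric bilinear form attached to two `ZMod 2`-valued functions on vertices, evaluated
on unordered pairs. -/
def pairForm {V : Type*} (g h : V → ZMod 2) : Sym2 V → ZMod 2 :=
  Sym2.lift ⟨fun x y => g x * h y + g y * h x, fun _ _ => add_comm _ _⟩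

theorem pairForm_mk {V : Type*} (g h : V → ZMod 2) (x y : V) :
    pairForm g h s(x, y) = g x * h y + g y * h x := rfl

theorem sum_map_edges_eq_add {V : Type*} {G : SimpleGraph V} {φ : Sym2 V → ZMod 2}
    {g : V → ZMod 2} {a b : V} (q : G.Walk a b)
    (h : ∀ x y, s(x, y) ∈ q.edges → φ s(x, y) = g x + g y) :
    (q.edges.map φ).sum = g a + g b := by
  induction q with
  | nil => simp [CharTwo.add_self_eq_zero]
  | @cons u w b hadj q ih =>
    rw [Walk.edges_cons, List.map_cons, List.sum_cons,
      ih fun x y hxy => h x y (by simp [hxy]), h u w (by simp)]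
    linear_combination CharTwo.add_self_eq_zero (g w)

theorem sum_map_edges_eq_sum_range {V M : Type*} [AddCommMonoid M] {G : SimpleGraph V}
    (φ : Sym2 V → M) {a b : V} (q : G.Walk a b) :
    (q.edges.map φ).sum =
      ∑ z ∈ Finset.range q.length, φ s(q.getVert z, q.getVert (z + 1)) := by
  induction q with
  | nil => simp
  | cons h q ih =>
    rw [Walk.length_cons, Finset.sum_range_succ']
    simp [ih, add_comm (φ _)]

theorem sum_map_edges_eq_of_odd {V ι : Type*} [Finite V] [Fintype ι] {G : SimpleGraph V} {v : V}
    {c : G.Walk v v} (hc : c.IsCycle) {u : ι → V} {D : ∀ i, G.Walk (u i) (u i)}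
    (hD : ∀ i, (D i).IsCycle)
    (hsum : ∀ e : Sym2 V, e ∈ c.edges ↔ Odd {i : ι | e ∈ (D i).edges}.ncard)
    (φ : Sym2 V → ZMod 2) :
    (c.edges.map φ).sum = ∑ i, ((D i).edges.map φ).sum := by
  classical
  have := Fintype.ofFinite V
  have hlist : ∀ l : List (Sym2 V), l.Nodup →
      (l.map φ).sum = ∑ e : Sym2 V, if e ∈ l then φ e else 0 := by
    intro l hl
    rw [← List.sum_toFinset φ hl, ← Finset.sum_filter]
    congr 1
    ext e
    simp
  rw [hlist _ hc.edges_nodup, Finset.sum_congr rfl fun i _ => hlist _ (hD i).edges_nodup,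
    Finset.sum_comm]
  refine Finset.sum_congr rfl fun e _ => ?_
  rw [← Finset.sum_filter, Finset.sum_const, nsmul_eq_mul]
  have hcard : {i : ι | e ∈ (D i).edges}.ncard =
      (Finset.univ.filter fun i => e ∈ (D i).edges).card := by
    rw [← Set.ncard_coe_finset]
    simp
  by_cases he : e ∈ c.edges
  · have h1 := (hsum e).1 he
    rw [hcard, ← ZMod.natCast_eq_one_iff_odd] at h1
    rw [if_pos he, h1, one_mul]
  · have h1 := mt (hsum e).2 he
    rw [hcard, Nat.not_odd_iff_even, ← ZMod.natCast_eq_zero_iff_even] at h1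
    rw [if_neg he, h1, zero_mul]

/-- The vertices of a closed walk, indexed periodically by the integers. -/
def cyclicVert {V : Type*} {G : SimpleGraph V} {v : V} (c : G.Walk v v) (z : ℤ) : V :=
  c.getVert (z % c.length).toNat

section Cycle

variable {V : Type*} {G : SimpleGraph V} {v : V} {c : G.Walk v v}

theorem cyclicVert_natCast {j : ℕ} (hj : j ≤ c.length) : cyclicVert c j = c.getVert j := by
  unfold cyclicVert
  rcases hj.eq_or_lt with rfl | hj
  · simp
  · rw [Int.emod_eq_of_lt (by omega) (by omega), Int.toNat_natCast]

theorem cyclicVert_congr {z w : ℤ} (h : z ≡ w [ZMOD c.length]) :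
    cyclicVert c z = cyclicVert c w := by
  unfold cyclicVert
  rw [h.eq]

theorem modEq_of_cyclicVert_eq (hc : c.IsCycle) {z w : ℤ} (h : cyclicVert c z = cyclicVert c w) :
    z ≡ w [ZMOD c.length] := by
  have hn := hc.three_le_length
  have hz := Int.emod_nonneg z (b := c.length) (by omega)
  have hz' := Int.emod_lt_of_pos z (b := c.length) (by omega)
  have hw := Int.emod_nonneg w (b := c.length) (by omega)
  have hw' := Int.emod_lt_of_pos w (b := c.length) (by omega)
  have := hc.getVert_injOn' (by simp only [Set.mem_ofPred_eq]; omega)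
    (by simp only [Set.mem_ofPred_eq]; omega) h
  unfold Int.ModEq
  omega

theorem exists_getVert_lt_of_mem_support (hc : c.IsCycle) {a : V} (ha : a ∈ c.support) :
    ∃ j < c.length, c.getVert j = a := by
  have hn := hc.three_le_length
  obtain ⟨j, rfl, hj⟩ := Walk.mem_support_iff_exists_getVert.1 ha
  rcases hj.eq_or_lt with rfl | hj
  · exact ⟨0, by omega, by simp⟩
  · exact ⟨j, hj, rfl⟩

theorem ncard_support_of_isCycle (hc : c.IsCycle) : {x | x ∈ c.support}.ncard = c.length := by
  have hn := hc.three_le_length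
  have himg : {x | x ∈ c.support} = c.getVert '' (Finset.range c.length : Set ℕ) := by
    ext x
    simp only [Set.mem_ofPred_eq, Set.mem_image, Finset.coe_range, Set.mem_Iio]
    exact ⟨exists_getVert_lt_of_mem_support hc, by
      rintro ⟨j, -, rfl⟩; exact c.getVert_mem_support j⟩
  rw [himg, Set.InjOn.ncard_image, Set.ncard_coe_finset, Finset.card_range]
  refine hc.getVert_injOn'.mono fun j hj => ?_
  simp only [Finset.coe_range, Set.mem_Iio, Set.mem_ofPred_eq] at hj ⊢
  omega

theorem exists_cyclicVert_eq_of_walk (hc : c.IsCycle) {a b : V}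
    (q : (SimpleGraph.fromEdgeSet {e : Sym2 V | e ∈ c.edges}).Walk a b) {m : ℤ}
    (ha : cyclicVert c m = a) :
    ∃ w : ℤ, cyclicVert c w = b ∧ |w - m| ≤ q.length := by
  induction q generalizing m with
  | nil => exact ⟨m, ha, by simp⟩
  | @cons a x b h q ih =>
    obtain ⟨m', hm', hd⟩ : ∃ m', cyclicVert c m' = x ∧ |m' - m| ≤ 1 := by
      rw [SimpleGraph.fromEdgeSet_adj] at h
      obtain ⟨i, hi, he⟩ := (Walk.mk_mem_edges_iff_exists c).1 h.1
      rw [← cyclicVert_natCast hi.le, ← cyclicVert_natCast (j := i + 1) hi, Sym2.eq_iff] at he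
      rcases he with ⟨h1, h2⟩ | ⟨h1, h2⟩
      · refine ⟨m + 1, ?_, by simp⟩
        rw [← h2]
        push_cast
        exact cyclicVert_congr ((modEq_of_cyclicVert_eq hc (ha.trans h1.symm)).add_right 1)
      · refine ⟨m - 1, ?_, by simp⟩
        rw [← h1]
        refine cyclicVert_congr ?_
        have := (modEq_of_cyclicVert_eq hc (ha.trans h2.symm)).sub_right 1
        push_cast at this
        simpa using this
    obtain ⟨w, hw, hwd⟩ := ih hm'
    refine ⟨w, hw, ?_⟩
    rw [Walk.length_cons]
    push_cast
    have := abs_sub_le w m' m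
    omega

theorem reachable_fromEdgeSet_of_mem_support {a b : V} (ha : a ∈ c.support) (hb : b ∈ c.support) :
    (SimpleGraph.fromEdgeSet {e : Sym2 V | e ∈ c.edges}).Reachable a b := by
  classical
  have hcd : ∀ x ∈ c.support,
      (SimpleGraph.fromEdgeSet {e : Sym2 V | e ∈ c.edges}).Reachable v x := by
    intro x hx
    refine ⟨(c.takeUntil x hx).transfer _ fun e he => ?_⟩
    rw [SimpleGraph.edgeSet_fromEdgeSet]
    exact ⟨c.edges_takeUntil_subset_edges hx he,
      G.not_isDiag_of_mem_edgeSet (Walk.edges_subset_edgeSet _ he)⟩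
  exact (hcd a ha).symm.trans (hcd b hb)

/-- A set of vertices of a cycle with small radius can be covered by few vertices, such that for
any two uncovered vertices one of the two arcs between them misses the set. -/
theorem exists_cover_of_dist_le [Finite V] (hc : c.IsCycle) (Y : Set V) (r : ℕ)
    (hY : ∀ a ∈ Y, ∀ b ∈ Y, a ∈ c.support → b ∈ c.support →
      (SimpleGraph.fromEdgeSet {e : Sym2 V | e ∈ c.edges}).dist a b ≤ r) :
    ∃ B : Set V, B.ncard ≤ 2 * r + 1 ∧ (∀ y ∈ Y, y ∈ c.support → y ∈ B) ∧
      ∀ s t : ℕ, s < t → t < c.length → c.getVert s ∉ B → c.getVert t ∉ B →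
        (∀ j, s ≤ j → j ≤ t → c.getVert j ∉ Y) ∨
        (∀ j ≤ c.length, j ≤ s ∨ t ≤ j → c.getVert j ∉ Y) := by
  by_cases hne : ∃ y ∈ Y, y ∈ c.support
  swap
  · push Not at hne
    exact ⟨∅, by simp, fun y hy hyc => (hne y hy hyc).elim, fun s t _ _ _ _ =>
      Or.inl fun j _ _ hj => hne _ hj (c.getVert_mem_support j)⟩
  obtain ⟨y, hy, hyc⟩ := hne
  obtain ⟨m, hm, hmy⟩ := exists_getVert_lt_of_mem_support hc hyc
  have hcov : ∀ x ∈ Y, x ∈ c.support →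
      ∃ w : ℤ, cyclicVert c w = x ∧ (m : ℤ) - r ≤ w ∧ w ≤ m + r := by
    intro x hx hxc
    obtain ⟨q, hq⟩ :=
      (reachable_fromEdgeSet_of_mem_support hyc hxc).exists_walk_length_eq_dist
    obtain ⟨w, hw, hwd⟩ := exists_cyclicVert_eq_of_walk hc q
      (m := m) ((cyclicVert_natCast hm.le).trans hmy)
    have := hY y hy x hx hyc hxc
    rw [abs_le] at hwd
    exact ⟨w, hw, by omega, by omega⟩
  refine ⟨cyclicVert c '' (Finset.Icc ((m : ℤ) - r) (m + r) : Set ℤ), ?_, ?_, ?_⟩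
  · refine (Set.ncard_image_le (Finset.finite_toSet _)).trans ?_
    rw [Set.ncard_coe_finset, Int.card_Icc]
    omega
  · intro x hx hxc
    obtain ⟨w, hw, h1, h2⟩ := hcov x hx hxc
    exact ⟨w, by simp [h1, h2], hw⟩
  · intro s t hst htn hs ht
    have havoid : ∀ (s : ℕ), s < c.length →
        c.getVert s ∉ cyclicVert c '' (Finset.Icc ((m : ℤ) - r) (m + r) : Set ℤ) →
        ∀ w : ℤ, (m : ℤ) - r ≤ w → w ≤ m + r → w ≠ s ∧ w ≠ s - c.length ∧ w ≠ s + c.length := by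
      intro s hsn hs w h1 h2
      rw [← cyclicVert_natCast hsn.le] at hs
      have hmem : w ∈ (Finset.Icc ((m : ℤ) - r) (m + r) : Set ℤ) := by
        rw [Finset.coe_Icc]
        exact ⟨h1, h2⟩
      refine ⟨?_, ?_, ?_⟩ <;> rintro rfl <;> refine hs ⟨_, hmem, ?_⟩
      · rfl
      · exact cyclicVert_congr (by simp [Int.ModEq])
      · exact cyclicVert_congr (by simp [Int.ModEq])
    have hs0 := havoid s (hst.trans htn) hs
    have ht0 := havoid t htn ht
    have hidx : ∀ j ≤ c.length, c.getVert j ∈ Y →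
        ∃ w : ℤ, (m : ℤ) - r ≤ w ∧ w ≤ m + r ∧ ((j : ℤ) ≤ w - 2 * c.length ∨
          (j : ℤ) = w - c.length ∨ (j : ℤ) = w ∨ (j : ℤ) = w + c.length ∨
          w + 2 * c.length ≤ (j : ℤ)) := by
      intro j hj hjY
      obtain ⟨w, hw, h1, h2⟩ := hcov _ hjY (c.getVert_mem_support j)
      rw [← cyclicVert_natCast hj] at hw
      obtain ⟨q, hq⟩ := (modEq_of_cyclicVert_eq hc hw).dvd
      refine ⟨w, h1, h2, ?_⟩
      obtain h | rfl | rfl | rfl | h : q ≤ -2 ∨ q = -1 ∨ q = 0 ∨ q = 1 ∨ 2 ≤ q := by omega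
      · left; nlinarith
      · omega
      · omega
      · omega
      · right; right; right; right; nlinarith
    have hbound : ∀ x : ℤ, (∀ w : ℤ, (m : ℤ) - r ≤ w → w ≤ m + r → w ≠ x) →
        x < m - r ∨ (m : ℤ) + r < x := by
      intro x hx
      by_contra! h
      exact hx x h.1 h.2 rfl
    have b1 := hbound s fun w h1 h2 => (hs0 w h1 h2).1
    have b2 := hbound (s + c.length) fun w h1 h2 => (hs0 w h1 h2).2.2
    have b3 := hbound t fun w h1 h2 => (ht0 w h1 h2).1
    have b4 := hbound (t - c.length) fun w h1 h2 => (ht0 w h1 h2).2.1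
    by_cases hmid : s < m ∧ m < t
    · right
      intro j hj hjst hjY
      obtain ⟨w, h1, h2, h3⟩ := hidx j hj hjY
      omega
    · left
      intro j hj1 hj2 hjY
      obtain ⟨w, h1, h2, h3⟩ := hidx j (by omega) hjY
      omega

end Cycle

theorem sum_Ico_add_succ_zmod_two (g : ℕ → ZMod 2) {s t : ℕ} (hst : s ≤ t) :
    ∑ z ∈ Finset.Ico s t, (g z + g (z + 1)) = g s + g t := by
  induction t, hst using Nat.le_induction with
  | base => simp [CharTwo.add_self_eq_zero]
  | succ t hst ih =>
    rw [Finset.sum_Ico_succ_top hst, ih]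
    linear_combination CharTwo.add_self_eq_zero (g t)

theorem exists_walk_two_mul_length_le {V : Type*} {G : SimpleGraph V} {a x y : V} (w : G.Walk a a)
    (hx : x ∈ w.support) (hy : y ∈ w.support) :
    ∃ r : G.Walk x y, 2 * r.length ≤ w.length := by
  classical
  have hy' : y ∈ (w.rotate x hx).support := by
    simpa using hy
  have hlen := congrArg Walk.length ((w.rotate x hx).take_spec hy')
  rw [Walk.length_append, Walk.length_rotate] at hlen
  rcases le_total ((w.rotate x hx).takeUntil y hy').length
    ((w.rotate x hx).dropUntil y hy').length with h | h
  · exact ⟨(w.rotate x hx).takeUntil y hy', by omega⟩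
  · exact ⟨((w.rotate x hx).dropUntil y hy').reverse, by rw [Walk.length_reverse]; omega⟩

section Clusters

variable {V ι : Type*} {G : SimpleGraph V} {v : V} {c : G.Walk v v}
  {u : ι → V} {D : ∀ i, G.Walk (u i) (u i)}

/-- Let `K` be a union of components of `G - X`, and let `X` be partitioned into clusters so that
no cycle `D i` meets two of them. If every cluster misses one of the two arcs of `c` between two
vertices, then `K` contains both of these vertices or none. -/
theorem getVert_mem_iff_of_clusters [Finite V] [Fintype ι] (hc : c.IsCycle)
    (hD : ∀ i, (D i).IsCycle)
    (hsum : ∀ e : Sym2 V, e ∈ c.edges ↔ Odd {i : ι | e ∈ (D i).edges}.ncard)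
    {X K : Set V} (hKX : ∀ x ∈ K, x ∉ X) (hK : ∀ x ∈ K, ∀ y, G.Adj x y → y ∉ X → y ∈ K)
    {κ : Type*} [Finite κ] (cl : V → κ)
    (hcl : ∀ i, ∀ x ∈ X, ∀ y ∈ X, x ∈ (D i).support → y ∈ (D i).support → cl x = cl y)
    {s t : ℕ} (hst : s < t) (htn : t < c.length)
    (harc : ∀ k, (∀ j, s ≤ j → j ≤ t → c.getVert j ∉ {x | x ∈ X ∧ cl x = k}) ∨
      (∀ j ≤ c.length, j ≤ s ∨ t ≤ j → c.getVert j ∉ {x | x ∈ X ∧ cl x = k})) :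
    c.getVert s ∈ K ↔ c.getVert t ∈ K := by
  classical
  have := Fintype.ofFinite κ
  let g : V → ZMod 2 := fun x => if x ∈ K then 1 else 0
  let η : κ → V → ZMod 2 := fun k x => if x ∈ X ∧ cl x = k then 1 else 0
  have hX : ∀ x y, G.Adj x y → x ∈ K → y ∉ K → y ∈ X := fun x y hxy hx hy => by
    by_contra h
    exact hy (hK x hx y hxy h)
  have hcross : ∀ (h : V → ZMod 2) (x y : V), G.Adj x y → (∀ z, z ∉ X → h z = 0) →
      (x ∈ X → h x = 1) → (y ∈ X → h y = 1) → pairForm g h s(x, y) = g x + g y := by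
    intro h x y hxy h0 hx1 hy1
    rw [pairForm_mk]
    by_cases hx : x ∈ K <;> by_cases hy : y ∈ K
    · simp only [g, hx, hy, if_true, h0 x (hKX x hx), h0 y (hKX y hy)]
      decide
    · simp [g, hx, hy, hy1 (hX x y hxy hx hy)]
    · simp [g, hx, hy, hx1 (hX y x hxy.symm hy hx)]
    · simp [g, hx, hy]
  have htotal : ∀ k, (c.edges.map (pairForm g (η k))).sum = 0 := by
    intro k
    rw [sum_map_edges_eq_of_odd hc hD hsum]
    refine Finset.sum_eq_zero fun i _ => ?_
    by_cases hmeet : ∃ x ∈ X, x ∈ (D i).support ∧ cl x = k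
    · obtain ⟨w, hwX, hwD, hwk⟩ := hmeet
      have hη : ∀ x ∈ (D i).support, x ∈ X → η k x = 1 := fun x hx hxX =>
        if_pos ⟨hxX, (hcl i x hxX w hwX hx hwD).trans hwk⟩
      rw [sum_map_edges_eq_add (g := g) (D i) fun x y hxy => ?_, CharTwo.add_self_eq_zero]
      exact hcross _ x y ((D i).adj_of_mem_edges hxy) (fun z hz => if_neg fun h => hz h.1)
        (hη x ((D i).fst_mem_support_of_mem_edges hxy))
        (hη y ((D i).snd_mem_support_of_mem_edges hxy))
    · push Not at hmeet
      have hη : ∀ x ∈ (D i).support, η k x = 0 := fun x hx =>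
        if_neg fun h => hmeet x h.1 hx h.2
      rw [sum_map_edges_eq_add (g := fun _ => 0) (D i) fun x y hxy => ?_, add_zero]
      rw [pairForm_mk, hη x ((D i).fst_mem_support_of_mem_edges hxy),
        hη y ((D i).snd_mem_support_of_mem_edges hxy)]
      simp
  have hpart : ∀ k, ∑ z ∈ Finset.Ico s t,
      pairForm g (η k) s(c.getVert z, c.getVert (z + 1)) = 0 := by
    intro k
    have hzero : ∀ z, c.getVert z ∉ {x | x ∈ X ∧ cl x = k} →
        c.getVert (z + 1) ∉ {x | x ∈ X ∧ cl x = k} →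
        pairForm g (η k) s(c.getVert z, c.getVert (z + 1)) = 0 := by
      intro z h1 h2
      rw [pairForm_mk, show η k (c.getVert z) = 0 from if_neg h1,
        show η k (c.getVert (z + 1)) = 0 from if_neg h2]
      simp
    rcases harc k with h | h
    · refine Finset.sum_eq_zero fun z hz => ?_
      rw [Finset.mem_Ico] at hz
      exact hzero z (h z hz.1 hz.2.le) (h _ (by omega) hz.2)
    · have htot := htotal k
      rw [sum_map_edges_eq_sum_range, Finset.range_eq_Ico,
        ← Finset.sum_Ico_consecutive _ (Nat.zero_le s) (hst.trans htn).le,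
        ← Finset.sum_Ico_consecutive _ hst.le htn.le] at htot
      rw [Finset.sum_eq_zero (s := Finset.Ico 0 s) fun z hz => ?_,
        Finset.sum_eq_zero (s := Finset.Ico t c.length) fun z hz => ?_, zero_add,
        add_zero] at htot
      · exact htot
      · rw [Finset.mem_Ico] at hz
        exact hzero z (h z (by omega) (by omega)) (h _ (by omega) (by omega))
      · rw [Finset.mem_Ico] at hz
        exact hzero z (h z (by omega) (by omega)) (h _ (by omega) (by omega))
  have hsumη : ∀ x, ∑ k, η k x = if x ∈ X then 1 else 0 := by
    intro x
    by_cases hx : x ∈ X <;> simp [η, hx]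
  have hfinal : g (c.getVert s) + g (c.getVert t) = 0 := by
    rw [← sum_Ico_add_succ_zmod_two (fun z => g (c.getVert z)) hst.le,
      ← Finset.sum_eq_zero (s := Finset.univ) fun k _ => hpart k, Finset.sum_comm]
    refine Finset.sum_congr rfl fun z hz => ?_
    rw [Finset.mem_Ico] at hz
    rw [← hcross (fun x => ∑ k, η k x) _ _ (c.adj_getVert_succ (by omega))
      (fun z hz => by simp [hsumη, hz]) (fun h => by simp [hsumη, h])
      (fun h => by simp [hsumη, h])]
    simp only [pairForm_mk, Finset.mul_sum, Finset.sum_add_distrib]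
  by_cases hs : c.getVert s ∈ K <;> by_cases ht : c.getVert t ∈ K <;> simp_all [g]

/-- The graph on `X` joining two vertices if some cycle `D i` contains both. -/
def sharingGraph (D : ∀ i, G.Walk (u i) (u i)) (X : Set V) : SimpleGraph V where
  Adj x y := x ≠ y ∧ x ∈ X ∧ y ∈ X ∧ ∃ i, x ∈ (D i).support ∧ y ∈ (D i).support
  symm := ⟨fun _ _ ⟨h, hx, hy, i, h1, h2⟩ => ⟨h.symm, hy, hx, i, h2, h1⟩⟩
  loopless := ⟨fun _ h => h.1 rfl⟩

theorem exists_walk_of_sharingGraph_walk {p : ℕ} (hshort : ∀ i, (D i).length ≤ p) {X : Set V}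
    {x y : V} (q : (sharingGraph D X).Walk x y) :
    ∃ r : G.Walk x y, 2 * r.length ≤ p * q.length := by
  induction q with
  | nil => exact ⟨Walk.nil, by simp⟩
  | cons h q ih =>
    obtain ⟨i, h1, h2⟩ := h.2.2.2
    obtain ⟨r, hr⟩ := ih
    obtain ⟨r', hr'⟩ := exists_walk_two_mul_length_le (D i) h1 h2
    refine ⟨r'.append r, ?_⟩
    have := hshort i
    rw [Walk.length_append, Walk.length_cons, mul_add, mul_add]
    omega

theorem two_mul_dist_le_of_cluster [Finite V] {p : ℕ} (hshort : ∀ i, (D i).length ≤ p) {X : Set V}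
    (k : (sharingGraph D X).ConnectedComponent) {x y : V}
    (hx : x ∈ X) (hxk : (sharingGraph D X).connectedComponentMk x = k)
    (hyk : (sharingGraph D X).connectedComponentMk y = k) :
    2 * G.dist x y ≤
      p * ({z | z ∈ X ∧ (sharingGraph D X).connectedComponentMk z = k}.ncard - 1) := by
  classical
  obtain ⟨q, hq⟩ := (ConnectedComponent.exact (hxk.trans hyk.symm)).exists_isPath
  obtain ⟨r, hr⟩ := exists_walk_of_sharingGraph_walk hshort q
  have hsub : (q.support.toFinset : Set V) ⊆
      {z | z ∈ X ∧ (sharingGraph D X).connectedComponentMk z = k} := by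
    intro z hz
    rw [List.coe_toFinset] at hz
    refine mem_of_walk_of_closed (X := ∅)
      (K := {z | z ∈ X ∧ (sharingGraph D X).connectedComponentMk z = k}) ?_ q (by simp)
      ⟨hx, hxk⟩ z hz
    rintro a ⟨-, hak⟩ b hab -
    exact ⟨hab.2.2.1, (ConnectedComponent.sound hab.symm.reachable).trans hak⟩
  have hcard := Set.ncard_le_ncard hsub (Set.toFinite _)
  rw [Set.ncard_coe_finset, List.toFinset_card_of_nodup hq.support_nodup,
    Walk.length_support] at hcard
  calc 2 * G.dist x y ≤ 2 * r.length := Nat.mul_le_mul_left _ (G.dist_le r)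
    _ ≤ p * q.length := hr
    _ ≤ _ := Nat.mul_le_mul_left _ (by omega)

/-- A set of few vertices leaves a component containing more than half of the cycle `c`. -/
theorem exists_majority_avoidComp [Finite V] [Fintype ι] {k p : ℕ} {γ : ℝ} (hγ : 1 ≤ γ)
    (hc : c.IsCycle)
    (hlen : 2 * γ * p * k ≤ (c.length : ℝ))
    (hdist : ∀ a ∈ c.support, ∀ b ∈ c.support,
      (((SimpleGraph.fromEdgeSet {e : Sym2 V | e ∈ c.edges}).dist a b : ℝ)) ≤
        γ * (G.dist a b : ℝ))
    (hD : ∀ i, (D i).IsCycle) (hshort : ∀ i, (D i).length ≤ p)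
    (hsum : ∀ e : Sym2 V, e ∈ c.edges ↔ Odd {i : ι | e ∈ (D i).edges}.ncard)
    {X : Set V} (hX : X.ncard ≤ k) :
    ∃ a, a ∉ X ∧
      {x | x ∈ c.support}.ncard < 2 * (avoidComp G X a ∩ {x | x ∈ c.support}).ncard := by
  classical
  have hn := hc.three_le_length
  have hp : 3 ≤ p := by
    obtain ⟨e, he⟩ := List.exists_mem_of_length_pos (l := c.edges) (by rw [c.length_edges]; omega)
    obtain ⟨i, -⟩ := Set.nonempty_of_ncard_ne_zero ((hsum e).1 he).pos.ne'
    exact (hD i).three_le_length.trans (hshort i)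
  have hγp : 3 ≤ γ * p := by
    have : (3 : ℝ) ≤ p := by exact_mod_cast hp
    nlinarith
  let cl := (sharingGraph D X).connectedComponentMk
  let Y : (sharingGraph D X).ConnectedComponent → Set V := fun κ => {z | z ∈ X ∧ cl z = κ}
  have hYr : ∀ κ, ∀ a ∈ Y κ, ∀ b ∈ Y κ, a ∈ c.support → b ∈ c.support →
      (SimpleGraph.fromEdgeSet {e : Sym2 V | e ∈ c.edges}).dist a b ≤
        ⌊γ * p * ((Y κ).ncard - 1 : ℕ) / 2⌋₊ := by
    intro κ a ha b hb hac hbc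
    have h1 : (2 : ℝ) * G.dist a b ≤ p * ((Y κ).ncard - 1 : ℕ) := by
      exact_mod_cast two_mul_dist_le_of_cluster hshort κ ha.1 ha.2 hb.2
    refine Nat.le_floor ((hdist a hac b hbc).trans ?_)
    nlinarith
  choose B hBcard hBY hBarc using fun κ => exists_cover_of_dist_le hc (Y κ) _ (hYr κ)
  let S : Finset (sharingGraph D X).ConnectedComponent := (X.toFinite.toFinset).image cl
  have hS : ∀ x ∈ X, cl x ∈ S := fun x hx =>
    Finset.mem_image_of_mem _ ((Set.Finite.mem_toFinset _).2 hx)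
  let Bad : Set V := ⋃ κ ∈ S, B κ
  have hBcard' : ∀ κ ∈ S, ((B κ).ncard : ℝ) + 1 ≤ γ * p * (Y κ).ncard := by
    intro κ hκ
    obtain ⟨x, hx, rfl⟩ := Finset.mem_image.1 hκ
    have hpos : 0 < (Y (cl x)).ncard :=
      (Set.ncard_pos (Set.toFinite _)).2 ⟨x, (Set.Finite.mem_toFinset _).1 hx, rfl⟩
    have h1 : ((B (cl x)).ncard : ℝ) ≤ 2 * ⌊γ * p * ((Y (cl x)).ncard - 1 : ℕ) / 2⌋₊ + 1 := by
      exact_mod_cast hBcard (cl x)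
    have h2 := Nat.floor_le (a := γ * p * ((Y (cl x)).ncard - 1 : ℕ) / 2) (by positivity)
    rw [Nat.cast_sub hpos, Nat.cast_one] at h1 h2
    linarith
  have hYsum : ∑ κ ∈ S, (Y κ).ncard = X.ncard := by
    rw [Set.ncard_eq_toFinset_card X X.toFinite, Finset.card_eq_sum_card_image cl]
    refine Finset.sum_congr rfl fun κ _ => ?_
    rw [← Set.ncard_coe_finset]
    congr 1
    ext x
    simp [Y]
  have hBad : 2 * Bad.ncard < c.length := by
    have hle : (Bad.ncard : ℝ) ≤ ∑ κ ∈ S, ((B κ).ncard : ℝ) := by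
      exact_mod_cast Finset.set_ncard_biUnion_le S B
    have hle' : ∑ κ ∈ S, ((B κ).ncard : ℝ) + S.card ≤ γ * p * X.ncard := by
      calc ∑ κ ∈ S, ((B κ).ncard : ℝ) + S.card = ∑ κ ∈ S, (((B κ).ncard : ℝ) + 1) := by
            simp [Finset.sum_add_distrib]
        _ ≤ ∑ κ ∈ S, γ * p * (Y κ).ncard := Finset.sum_le_sum hBcard'
        _ = _ := by rw [← Finset.mul_sum, ← hYsum, Nat.cast_sum]
    rcases S.eq_empty_or_nonempty with hS0 | hS0
    · have : Bad = ∅ := by simp [Bad, hS0]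
      rw [this, Set.ncard_empty]
      omega
    · have h1 : (1 : ℝ) ≤ S.card := by exact_mod_cast hS0.card_pos
      have h2 : (X.ncard : ℝ) ≤ k := by exact_mod_cast hX
      have h3 : γ * p * X.ncard ≤ γ * p * k := mul_le_mul_of_nonneg_left h2 (by linarith)
      have : (2 : ℝ) * Bad.ncard < c.length := by linarith
      exact_mod_cast this
  have hXBad : ∀ x ∈ X, x ∈ c.support → x ∈ Bad := fun x hx hxc =>
    Set.mem_biUnion (hS x hx) (hBY _ x ⟨hx, rfl⟩ hxc)
  have hgood := Set.le_ncard_sdiff Bad {x | x ∈ c.support} (Set.toFinite _)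
  rw [ncard_support_of_isCycle hc] at hgood ⊢
  obtain ⟨a, hac, haB⟩ := Set.nonempty_of_ncard_ne_zero
    (s := {x | x ∈ c.support} \ Bad) (by omega)
  have haX : a ∉ X := fun h => haB (hXBad a h hac)
  refine ⟨a, haX, ?_⟩
  have hside : ∀ s t : ℕ, s < t → t < c.length → c.getVert s ∉ Bad → c.getVert t ∉ Bad →
      (c.getVert s ∈ avoidComp G X a ↔ c.getVert t ∈ avoidComp G X a) := by
    intro s t hst htn hs ht
    refine getVert_mem_iff_of_clusters hc hD hsum (fun _ => notMem_of_mem_avoidComp)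
      (fun x hx y => mem_avoidComp_of_adj hx) cl ?_ hst htn fun κ => ?_
    · intro i x hx y hy hxi hyi
      by_cases hxy : x = y
      · rw [hxy]
      · exact ConnectedComponent.sound
          (Adj.reachable (G := sharingGraph D X) ⟨hxy, hx, hy, i, hxi, hyi⟩)
    · by_cases hκ : κ ∈ S
      · exact hBarc κ s t hst htn (fun h => hs (Set.mem_biUnion hκ h))
          fun h => ht (Set.mem_biUnion hκ h)
      · exact Or.inl fun j _ _ hj => hκ (hj.2 ▸ hS _ hj.1)
  have hsub : {x | x ∈ c.support} \ Bad ⊆ avoidComp G X a ∩ {x | x ∈ c.support} := by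
    rintro b ⟨hbc, hbB⟩
    refine ⟨?_, hbc⟩
    obtain ⟨s, hs, rfl⟩ := exists_getVert_lt_of_mem_support hc hac
    obtain ⟨t, ht, rfl⟩ := exists_getVert_lt_of_mem_support hc hbc
    have hself := mem_avoidComp_self (G := G) haX
    rcases lt_trichotomy s t with h | rfl | h
    · exact (hside s t h ht haB hbB).1 hself
    · exact hself
    · exact (hside t s h hs hbB haB).2 hself
  have := Set.ncard_le_ncard hsub (Set.toFinite _)
  omega

end Clusters

theorem treewidth_ge_of_distorted_cycle
    {V : Type} [Fintype V] (G : SimpleGraph V) (k p : ℕ) (hk : 0 < k) (hp : 0 < p)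
    (γ : ℝ) (hγ : 1 ≤ γ)
    (v : V) (c : G.Walk v v) (hc : c.IsCycle)
    (hlen : 2 * γ * p * k ≤ (c.length : ℝ))
    (hdist : ∀ a ∈ c.support, ∀ b ∈ c.support,
      (((SimpleGraph.fromEdgeSet {e : Sym2 V | e ∈ c.edges}).dist a b : ℝ)) ≤
        γ * (G.dist a b : ℝ))
    (ι : Type) [Fintype ι] (u : ι → V) (D : ∀ i, G.Walk (u i) (u i))
    (hD : ∀ i, (D i).IsCycle) (hshort : ∀ i, (D i).length ≤ p)
    (hsum : ∀ e : Sym2 V, e ∈ c.edges ↔ Odd {i : ι | e ∈ (D i).edges}.ncard) :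
    k ≤ treewidth G :=
  le_treewidth_of_majority G {x | x ∈ c.support} fun _ hX =>
    exists_majority_avoidComp hγ hc hlen hdist hD hshort hsum hX
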